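/- arXiv:2210.15992 — 2 statements merged into one kernel-verified Lean document; each statement's English description precedes it below -/
import Mathlib

section
/- Let w solve w''(1+w²) - (5/2)w(w')² = C(1+w²)^{7/2} with C > 0 and initial conditions w(0) = 0, w'(0) = 0 on its maximal interval of existence. Then w'(x) = C(1+w(x)²)^{5/4} ∫₀ˣ (1+w(t)²)^{5/4} dt and w(x) = (C/2)(∫₀ˣ (1+w(t)²)^{5/4} dt)² for all x in the interval. -/
/-- Let `w` solve `w''(1+w²) - (5/2)w(w')² = C(1+w²)^{7/2}` with `C > 0` and
initial conditions `w(0) = 0`, `w'(0) = 0` on its (open) interval of existence `I`. Then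
`w'(x) = C(1+w(x)²)^{5/4} ∫₀ˣ (1+w(t)²)^{5/4} dt` and
`w(x) = (C/2)(∫₀ˣ (1+w(t)²)^{5/4} dt)²` for all `x ∈ I`. -/
theorem stmt4 (I : Set ℝ) (hI : IsOpen I) (hI' : Convex ℝ I) (h0 : (0 : ℝ) ∈ I)
    (w : ℝ → ℝ) (C : ℝ) (hC : 0 < C) (hw : ContDiffOn ℝ 2 w I)
    (hode : ∀ x ∈ I, deriv (deriv w) x * (1 + (w x) ^ 2)
      - (5 / 2) * w x * (deriv w x) ^ 2 = C * (1 + (w x) ^ 2) ^ ((7 : ℝ) / 2))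
    (hw0 : w 0 = 0) (hw'0 : deriv w 0 = 0) :
    ∀ x ∈ I,
      deriv w x = C * (1 + (w x) ^ 2) ^ ((5 : ℝ) / 4)
          * ∫ t in (0 : ℝ)..x, (1 + (w t) ^ 2) ^ ((5 : ℝ) / 4)
      ∧ w x = C / 2 * (∫ t in (0 : ℝ)..x, (1 + (w t) ^ 2) ^ ((5 : ℝ) / 4)) ^ 2 := by
  have hpos : ∀ x, 0 < 1 + (w x) ^ 2 := fun x => by positivity
  have hwd : ∀ x ∈ I, HasDerivAt w (deriv w x) x := fun x hx =>
    ((hw.differentiableOn (by norm_num)).differentiableAt (hI.mem_nhds hx)).hasDerivAt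
  have hd1 : ContDiffOn ℝ 1 (deriv w) I :=
    hw.deriv_of_isOpen hI (by norm_num)
  have hwdd : ∀ x ∈ I, HasDerivAt (deriv w) (deriv (deriv w) x) x := fun x hx =>
    ((hd1.differentiableOn (by norm_num)).differentiableAt (hI.mem_nhds hx)).hasDerivAt
  have hpc : ContinuousOn (fun t => (1 + (w t) ^ 2) ^ ((5 : ℝ) / 4)) I := by
    apply ContinuousOn.rpow_const
    · exact continuousOn_const.add (hw.continuousOn.pow 2)
    · intro x _
      exact Or.inl (hpos x).ne'
  have hF : ∀ x ∈ I, HasDerivAt (fun x => ∫ t in (0 : ℝ)..x, (1 + (w t) ^ 2) ^ ((5 : ℝ) / 4))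
      ((1 + (w x) ^ 2) ^ ((5 : ℝ) / 4)) x := by
    intro x hx
    apply intervalIntegral.integral_hasDerivAt_right
    · apply ContinuousOn.intervalIntegrable
      exact hpc.mono (hI'.ordConnected.uIcc_subset h0 hx)
    · exact hpc.stronglyMeasurableAtFilter hI x hx
    · exact hpc.continuousAt (hI.mem_nhds hx)
  have hconst : ∀ f : ℝ → ℝ, (∀ x ∈ I, HasDerivAt f 0 x) → f 0 = 0 → ∀ x ∈ I, f x = 0 := by
    intro f hf hf0 x hx
    rw [← hf0]
    exact hI.is_const_of_deriv_eq_zero hI'.isPreconnected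
      (fun y hy => (hf y hy).differentiableAt.differentiableWithinAt)
      (fun y hy => (hf y hy).deriv) hx h0
  have h1 : ∀ x ∈ I, deriv w x * (1 + (w x) ^ 2) ^ (-((5 : ℝ) / 4))
      - C * ∫ t in (0 : ℝ)..x, (1 + (w t) ^ 2) ^ ((5 : ℝ) / 4) = 0 := by
    apply hconst
    · intro x hx
      have hb : HasDerivAt (fun x => 1 + (w x) ^ 2) (2 * w x * deriv w x) x := by
        have := ((hwd x hx).pow 2).const_add 1
        simpa using this
      have hq := hb.rpow_const (p := -((5 : ℝ) / 4)) (Or.inl (hpos x).ne')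
      have := ((hwdd x hx).mul hq).sub ((hF x hx).const_mul C)
      refine this.congr_deriv ?_
      have e := hode x hx
      have hP := hpos x
      set b := 1 + (w x) ^ 2 with hbdef
      have e1 : b ^ (-((5 : ℝ) / 4)) = b * b ^ (-((5 : ℝ) / 4) - 1) := by
        rw [Real.rpow_sub_one hP.ne']
        field_simp
      have e2 : b ^ ((5 : ℝ) / 4) = b ^ ((7 : ℝ) / 2) * b ^ (-((5 : ℝ) / 4) - 1) := by
        rw [← Real.rpow_add hP]
        norm_num
      rw [e1, e2]
      linear_combination (b ^ (-((5 : ℝ) / 4) - 1)) * e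
    · simp [hw'0]
  have h2 : ∀ x ∈ I, deriv w x = C * (1 + (w x) ^ 2) ^ ((5 : ℝ) / 4)
          * ∫ t in (0 : ℝ)..x, (1 + (w t) ^ 2) ^ ((5 : ℝ) / 4) := by
    intro x hx
    have e := h1 x hx
    have e3 : (1 + (w x) ^ 2) ^ (-((5 : ℝ) / 4)) * (1 + (w x) ^ 2) ^ ((5 : ℝ) / 4) = 1 := by
      rw [← Real.rpow_add (hpos x)]
      norm_num
    linear_combination (1 + (w x) ^ 2) ^ ((5 : ℝ) / 4) * e - deriv w x * e3
  have h3 : ∀ x ∈ I, w x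
      - C / 2 * (∫ t in (0 : ℝ)..x, (1 + (w t) ^ 2) ^ ((5 : ℝ) / 4)) ^ 2 = 0 := by
    apply hconst
    · intro x hx
      have := (hwd x hx).sub (((hF x hx).pow 2).const_mul (C / 2))
      refine this.congr_deriv ?_
      rw [h2 x hx]
      norm_num
      ring
    · simp [hw0]
  exact fun x hx => ⟨h2 x hx, by linarith [h3 x hx]⟩
end

section
/- Let 𝓗_a solve 𝓗'' = −𝓗(1 + (1/2)𝓗²) with 𝓗_a(0) = a > 0, 𝓗_a'(0) = 0, and c_a its first positive zero. For any ε ∈ (0, 0.1), if 0 < a < √(2ε² + 4ε), then c_a ≥ π/(2(1+ε)). -/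
/-- Let `𝓗_a` solve `𝓗'' = −𝓗(1 + (1/2)𝓗²)` with `𝓗_a(0) = a > 0`,
`𝓗_a'(0) = 0`, and `c_a` its first positive zero. For any `ε ∈ (0, 0.1)`, if
`0 < a < √(2ε² + 4ε)`, then `c_a ≥ π/(2(1+ε))`. -/
theorem stmt12 (ε a : ℝ) (hε : ε ∈ Set.Ioo (0 : ℝ) 0.1)
    (ha : 0 < a) (ha' : a < Real.sqrt (2 * ε ^ 2 + 4 * ε))
    (𝓗 : ℝ → ℝ) (h𝓗 : ContDiff ℝ 2 𝓗)
    (hode : ∀ s : ℝ, deriv (deriv 𝓗) s = -𝓗 s * (1 + (1 / 2) * (𝓗 s) ^ 2))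
    (h0 : 𝓗 0 = a) (h'0 : deriv 𝓗 0 = 0) :
    Real.pi / (2 * (1 + ε)) ≤ sInf {s : ℝ | 0 < s ∧ 𝓗 s = 0} := by
  obtain ⟨hε0, hε1⟩ := hε
  have hk0 : 0 < 1 + ε := by linarith
  have ha2 : a ^ 2 < 2 * ε ^ 2 + 4 * ε := (Real.lt_sqrt ha.le).1 ha'
  have hd1 : ∀ s, HasDerivAt 𝓗 (deriv 𝓗 s) s := fun s =>
    (h𝓗.differentiable (by norm_num) s).hasDerivAt
  have hc1 : ContDiff ℝ 1 (deriv 𝓗) := by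
    have h2 : ContDiff ℝ (1 + 1) 𝓗 := by
      have e : (1 + 1 : WithTop ℕ∞) = 2 := by norm_num
      rw [e]; exact h𝓗
    exact (contDiff_succ_iff_deriv.1 h2).2.2
  have hd2 : ∀ s, HasDerivAt (deriv 𝓗) (-𝓗 s * (1 + (1 / 2) * (𝓗 s) ^ 2)) s := fun s => by
    rw [← hode s]
    exact (hc1.differentiable (by norm_num) s).hasDerivAt
  have hcont : Continuous 𝓗 := h𝓗.continuous
  -- conserved energy
  have hE : ∀ s, (deriv 𝓗 s) ^ 2 + 𝓗 s ^ 2 + 𝓗 s ^ 4 / 4 = a ^ 2 + a ^ 4 / 4 := by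
    have hd : ∀ s, HasDerivAt (fun s => (deriv 𝓗 s) ^ 2 + 𝓗 s ^ 2 + 𝓗 s ^ 4 / 4) 0 s := by
      intro s
      have := (((hd2 s).pow 2).add ((hd1 s).pow 2)).add (((hd1 s).pow 4).div_const 4)
      refine HasDerivAt.congr_deriv this ?_
      push_cast
      ring
    intro s
    have := is_const_of_deriv_eq_zero (fun s => (hd s).differentiableAt)
      (fun s => (hd s).deriv) s 0
    simp only [h0, h'0] at this
    linarith
  have hbd : ∀ s, 𝓗 s ^ 2 ≤ a ^ 2 := by
    intro s
    by_contra hcon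
    push Not at hcon
    have h4 := hE s
    nlinarith [sq_nonneg (deriv 𝓗 s), sq_nonneg a, sq_nonneg (𝓗 s)]
  -- positivity before zeros
  have hpos : ∀ x, (∀ s, 0 < s → s ≤ x → 𝓗 s ≠ 0) → ∀ s, 0 ≤ s → s ≤ x → 0 < 𝓗 s := by
    intro x hx s hs hsx
    by_contra hcon
    push Not at hcon
    obtain ⟨t, ht, hHt⟩ := intermediate_value_Icc' hs hcont.continuousOn
      (show (0 : ℝ) ∈ Set.Icc (𝓗 s) (𝓗 0) from ⟨hcon, by rw [h0]; exact ha.le⟩)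
    rcases ht.1.eq_or_lt with h | h
    · rw [← h, h0] at hHt; exact ha.ne' hHt
    · exact hx t h (ht.2.trans hsx) hHt
  -- the Wronskian against cos (k s)
  have hW : ∀ k s, HasDerivAt (fun s => deriv 𝓗 s * Real.cos (k * s) + k * (𝓗 s * Real.sin (k * s)))
      (𝓗 s * Real.cos (k * s) * (k ^ 2 - 1 - 𝓗 s ^ 2 / 2)) s := by
    intro k s
    have hl : HasDerivAt (fun s : ℝ => k * s) k s := by
      simpa using (hasDerivAt_id s).const_mul k
    have := ((hd2 s).mul hl.cos).add (((hd1 s).mul hl.sin).const_mul k)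
    refine HasDerivAt.congr_deriv this ?_
    ring
  apply le_csInf
  · by_contra hne
    have hno : ∀ s, 0 < s → 𝓗 s ≠ 0 := fun s hs h => hne ⟨s, hs, h⟩
    have hp := hpos (Real.pi / 2) (fun s hs _ => hno s hs)
    have hpi := Real.pi_pos
    have hanti : AntitoneOn (fun s => deriv 𝓗 s * Real.cos (1 * s) + 1 * (𝓗 s * Real.sin (1 * s)))
        (Set.Icc 0 (Real.pi / 2)) := by
      apply antitoneOn_of_deriv_nonpos (convex_Icc _ _)
      · exact fun s _ => (hW 1 s).continuousAt.continuousWithinAt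
      · exact fun s _ => (hW 1 s).differentiableAt.differentiableWithinAt
      · intro s hs
        rw [interior_Icc] at hs
        rw [(hW 1 s).deriv]
        have h1 := hp s hs.1.le hs.2.le
        have h2 : 0 ≤ Real.cos (1 * s) :=
          Real.cos_nonneg_of_neg_pi_div_two_le_of_le (by linarith [hs.1]) (by linarith [hs.2])
        apply mul_nonpos_of_nonneg_of_nonpos (mul_nonneg h1.le h2)
        nlinarith [sq_nonneg (𝓗 s)]
    have := hanti (Set.left_mem_Icc.2 (by positivity)) (Set.right_mem_Icc.2 (by positivity))
      (by positivity)
    simp [h'0] at this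
    linarith [hp (Real.pi / 2) (by positivity) le_rfl]
  · rintro b ⟨hb, hHb⟩
    by_contra hlt
    push Not at hlt
    obtain ⟨z, ⟨⟨hz0, hzb⟩, hHz⟩, hzmin⟩ :=
      (isCompact_Icc.inter_right (isClosed_singleton.preimage hcont) :
        IsCompact (Set.Icc 0 b ∩ 𝓗 ⁻¹' {0})).exists_isLeast ⟨b, ⟨hb.le, le_rfl⟩, hHb⟩
    have hHz' : 𝓗 z = 0 := hHz
    have hzpos : 0 < z := by
      rcases hz0.eq_or_lt with h | h
      · rw [← h, h0] at hHz'; exact absurd hHz' ha.ne'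
      · exact h
    have hp : ∀ s, 0 ≤ s → s < z → 0 < 𝓗 s := by
      intro s hs hsz
      refine hpos s (fun t ht hts h => ?_) s hs le_rfl
      have := hzmin ⟨⟨ht.le, by linarith⟩, h⟩
      linarith
    have hkb : (1 + ε) * b < Real.pi / 2 := by
      rw [lt_div_iff₀ (by positivity)] at hlt
      linarith
    have hkz : (1 + ε) * z < Real.pi / 2 := by nlinarith
    have hcos : ∀ s, 0 ≤ s → s ≤ z → 0 < Real.cos ((1 + ε) * s) := by
      intro s hs hsz
      have h1 : 0 ≤ (1 + ε) * s := by positivity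
      have h2 : (1 + ε) * s ≤ (1 + ε) * z := mul_le_mul_of_nonneg_left hsz hk0.le
      exact Real.cos_pos_of_mem_Ioo ⟨by linarith [Real.pi_pos], by linarith⟩
    have hmono : MonotoneOn (fun s => deriv 𝓗 s * Real.cos ((1 + ε) * s)
        + (1 + ε) * (𝓗 s * Real.sin ((1 + ε) * s))) (Set.Icc 0 z) := by
      apply monotoneOn_of_deriv_nonneg (convex_Icc _ _)
      · exact fun s _ => (hW _ s).continuousAt.continuousWithinAt
      · exact fun s _ => (hW _ s).differentiableAt.differentiableWithinAt
      · intro s hs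
        rw [interior_Icc] at hs
        rw [(hW _ s).deriv]
        have h1 := hp s hs.1.le hs.2
        apply mul_nonneg (mul_nonneg h1.le (hcos s hs.1.le hs.2.le).le)
        nlinarith [hbd s]
    have hW0 := hmono (Set.left_mem_Icc.2 hz0) (Set.right_mem_Icc.2 hz0) hz0
    simp [h'0, hHz'] at hW0
    have hanti : StrictAntiOn (deriv 𝓗) (Set.Icc 0 z) := by
      apply strictAntiOn_of_deriv_neg (convex_Icc _ _) hc1.continuous.continuousOn
      intro s hs
      rw [interior_Icc] at hs
      rw [hode s]
      have h1 := hp s hs.1.le hs.2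
      have : 0 < 𝓗 s * (1 + (1 / 2) * 𝓗 s ^ 2) := by positivity
      linarith
    have hneg := hanti (Set.left_mem_Icc.2 hz0) (Set.right_mem_Icc.2 hz0) hzpos
    rw [h'0] at hneg
    have := mul_neg_of_neg_of_pos hneg (hcos z hz0 le_rfl)
    linarith
end
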